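/- For every L ∈ ℕ, the set NN¹_L of functions ν ↦ ψ(∫_{H^L} h(φ)^(L) dν) on P(H^L), ranging over all L-layer MPNN models φ with Lipschitz readout ψ: ℝ^{d_L} → ℝ, is uniformly dense in C(P(H^L), ℝ), where P(H^L) carries the weak* topology. -/

import Mathlib

open MeasureTheory
open scoped ENNReal NNReal

/-- Unbalanced optimal transport distance (real valued) with ground cost `d`. -/
noncomputable def UOTr {α : Type*} [MeasurableSpace α] (d : α → α → ℝ) (μ ν : Measure α) : ℝ :=
  (if μ Set.univ ≤ ν Set.univ then
      sInf {c : ℝ | ∃ γ : Measure (α × α),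
        γ.map Prod.fst = μ ∧ γ.map Prod.snd ≤ ν ∧ c = ∫ q, d q.1 q.2 ∂γ}
    else
      sInf {c : ℝ | ∃ γ : Measure (α × α),
        γ.map Prod.fst = ν ∧ γ.map Prod.snd ≤ μ ∧ c = ∫ q, d q.1 q.2 ∂γ})
  + |(μ Set.univ).toReal - (ν Set.univ).toReal|

/-- One step of the iterated degree measure construction: from `(H^t, d_IDM^t)` produce
`(H^{t+1}, d_IDM^{t+1})` where `H^{t+1} = H^t × M_{≤1}(H^t)` (weak* topology on measures)
and the distance is the sum of the lower-level distance and unbalanced optimal transport. -/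
noncomputable def IDMstep :
    (Σ H : Type, TopologicalSpace H × (H → H → ℝ)) →
    Σ H : Type, TopologicalSpace H × (H → H → ℝ) := fun prev =>
  letI : TopologicalSpace prev.1 := prev.2.1
  letI : MeasurableSpace prev.1 := borel prev.1
  haveI : BorelSpace prev.1 := ⟨rfl⟩
  ⟨prev.1 × {μ : FiniteMeasure prev.1 // (μ : Measure prev.1) Set.univ ≤ 1},
    inferInstance,
    fun x y => prev.2.2 x.1 y.1 +
      UOTr prev.2.2 (x.2.1 : Measure prev.1) (y.2.1 : Measure prev.1)⟩

/-- The iterated degree measure spaces: `H^0` is the closed ball of radius `r` in `ℝ^p`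
with the euclidean metric, and `H^{t+1} = H^t × M_{≤1}(H^t)`. -/
noncomputable def IDMaux (p : ℕ) (r : ℝ) : ℕ → Σ H : Type, TopologicalSpace H × (H → H → ℝ)
  | 0 => ⟨Metric.closedBall (0 : EuclideanSpace ℝ (Fin p)) r, inferInstance,
          fun x y => dist x y⟩
  | t + 1 => IDMstep (IDMaux p r t)

/-- The space `H^t` of order-`t` iterated degree measures. -/
noncomputable def Hty (p : ℕ) (r : ℝ) (t : ℕ) : Type := (IDMaux p r t).1

noncomputable instance (p : ℕ) (r : ℝ) (t : ℕ) : TopologicalSpace (Hty p r t) :=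
  (IDMaux p r t).2.1

noncomputable instance (p : ℕ) (r : ℝ) (t : ℕ) : MeasurableSpace (Hty p r t) :=
  borel (Hty p r t)

instance (p : ℕ) (r : ℝ) (t : ℕ) : BorelSpace (Hty p r t) := ⟨rfl⟩

/-- The IDM metric `d_IDM^t` on `H^t`. -/
noncomputable def dIDM (p : ℕ) (r : ℝ) (t : ℕ) : Hty p r t → Hty p r t → ℝ :=
  (IDMaux p r t).2.2

/-- The space `M^{t+1} = M_{≤1}(H^t)` of sub-probability measures on `H^t`. -/
noncomputable def Mty (p : ℕ) (r : ℝ) (t : ℕ) : Type :=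
  {μ : FiniteMeasure (Hty p r t) // (μ : Measure (Hty p r t)) Set.univ ≤ 1}

/-- `H^{t+1}` is (definitionally) `H^t × M^{t+1}`. -/
noncomputable def toProd (p : ℕ) (r : ℝ) (t : ℕ) :
    Hty p r (t + 1) → Hty p r t × Mty p r t := fun τ => τ

/-- `H^0` is (definitionally) the closed ball of radius `r` in `ℝ^p`. -/
noncomputable def toBall (p : ℕ) (r : ℝ) : Hty p r 0 → EuclideanSpace ℝ (Fin p) :=
  fun τ => (show (Metric.closedBall (0 : EuclideanSpace ℝ (Fin p)) r : Set _) from ↑τ)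

/-- The canonical projection `p_{t+1,t} : H^{t+1} → H^t`. -/
noncomputable def projH (p : ℕ) (r : ℝ) (t : ℕ) : Hty p r (t + 1) → Hty p r t :=
  fun τ => (toProd p r t τ).1

/-- The canonical projection `p_{t+1} : H^{t+1} → M^{t+1}`, as a measure on `H^t`. -/
noncomputable def measOf (p : ℕ) (r : ℝ) (t : ℕ) (τ : Hty p r (t + 1)) :
    Measure (Hty p r t) := ((toProd p r t τ).2.1 : Measure (Hty p r t))

/-- An MPNN model: a sequence of Lipschitz update functions `φ^(t)`, where
`φ^(0) : ℝ^p → ℝ^{d_0}` and `φ^(t+1) : ℝ^{d_t} × ℝ^{d_t} → ℝ^{d_{t+1}}`. -/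
structure MPNN (p : ℕ) where
  dims : ℕ → ℕ
  K0 : ℝ≥0
  Ks : ℕ → ℝ≥0
  φ0 : EuclideanSpace ℝ (Fin p) → EuclideanSpace ℝ (Fin (dims 0))
  φ : (t : ℕ) → EuclideanSpace ℝ (Fin (dims t)) × EuclideanSpace ℝ (Fin (dims t)) →
        EuclideanSpace ℝ (Fin (dims (t + 1)))
  lip0 : LipschitzWith K0 φ0
  lip : ∀ t, LipschitzWith (Ks t) (φ t)

/-- The IDM feature maps `h^{(t)} : H^t → ℝ^{d_t}` of an MPNN model:
`h^{(0)}_τ = φ^{(0)}(τ)` and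
`h^{(t+1)}_τ = φ^{(t+1)}(h^{(t)}_{p_{t+1,t}(τ)}, ∫_{H^t} h^{(t)} d p_{t+1}(τ))`. -/
noncomputable def feat (p : ℕ) (r : ℝ) (Φ : MPNN p) :
    (t : ℕ) → Hty p r t → EuclideanSpace ℝ (Fin (Φ.dims t))
  | 0 => fun τ => Φ.φ0 (toBall p r τ)
  | t + 1 => fun τ =>
      Φ.φ t (feat p r Φ t (projH p r t τ), ∫ x, feat p r Φ t x ∂(measOf p r t τ))

/-- The set `NN¹_L` of scalar-valued MPNN outputs with readout on `P(H^L)`: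
functions `ν ↦ ψ(∫_{H^L} h(φ)^{(L)} dν)` for `L`-layer MPNN models `φ` and Lipschitz
readouts `ψ : ℝ^{d_L} → ℝ`. -/
noncomputable def NNL (p : ℕ) (r : ℝ) (L : ℕ) :
    Set (ProbabilityMeasure (Hty p r L) → ℝ) :=
  {F | ∃ (Φ : MPNN p) (ψ : EuclideanSpace ℝ (Fin (Φ.dims L)) → ℝ) (K : ℝ≥0),
    LipschitzWith K ψ ∧
    ∀ ν : ProbabilityMeasure (Hty p r L),
      F ν = ψ (∫ x, feat p r Φ L x ∂(ν : Measure (Hty p r L)))}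


section Generic
open TopologicalSpace

theorem aux_subprob_compact (X : Type) [TopologicalSpace X] [MeasurableSpace X] [BorelSpace X]
    [T2Space X] [CompactSpace X] :
    CompactSpace {μ : FiniteMeasure X // (μ : Measure X) Set.univ ≤ 1} := by
  have h := isCompact_setOfPred_finiteMeasure_le_of_compactSpace X 1
  have h2 : {μ : FiniteMeasure X | (μ : Measure X) Set.univ ≤ 1} = {μ | μ.mass ≤ 1} := by
    ext μ
    simp only [Set.mem_ofPred_eq]
    rw [← FiniteMeasure.ennreal_mass]
    exact_mod_cast Iff.rfl
  rw [← h2] at h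
  exact isCompact_iff_compactSpace.mp h

theorem aux_sep {X : Type} [TopologicalSpace X] [MeasurableSpace X] [BorelSpace X]
    [CompactSpace X] [MetrizableSpace X] {μ ν : Measure X} [IsFiniteMeasure μ] [IsFiniteMeasure ν]
    (S : Set C(X, ℝ)) (hS : Dense S) (h : ∀ f ∈ S, ∫ x, f x ∂μ = ∫ x, f x ∂ν) : μ = ν := by
  have key : ∀ ρ : Measure X, IsFiniteMeasure ρ → Continuous (fun f : C(X, ℝ) => ∫ x, f x ∂ρ) := by
    intro ρ _
    refine (LipschitzWith.of_dist_le_mul (K := (ρ Set.univ).toNNReal) fun f g => ?_).continuous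
    have hi : ∀ f : C(X, ℝ), Integrable (fun x => f x) ρ := fun f =>
      f.continuous.integrable_of_hasCompactSupport (HasCompactSupport.of_compactSpace f)
    rw [dist_eq_norm, ← integral_sub (hi f) (hi g)]
    have := norm_integral_le_of_norm_le_const (μ := ρ) (f := fun x => f x - g x) (C := dist f g)
      (Filter.Eventually.of_forall fun x => by
        rw [← dist_eq_norm]; exact ContinuousMap.dist_apply_le_dist x)
    rw [mul_comm]
    exact this
  have h3 : (fun f : C(X, ℝ) => ∫ x, f x ∂μ) = fun f => ∫ x, f x ∂ν :=
    Continuous.ext_on hS (key μ inferInstance) (key ν inferInstance) h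
  apply ext_of_forall_integral_eq_of_IsFiniteMeasure
  intro f
  exact congrFun h3 f.toContinuousMap

theorem aux_subprob_metrizable (X : Type) [TopologicalSpace X] [MeasurableSpace X] [BorelSpace X]
    [CompactSpace X] [MetrizableSpace X] :
    MetrizableSpace {μ : FiniteMeasure X // (μ : Measure X) Set.univ ≤ 1} := by
  have := aux_subprob_compact X
  refine Metric.PiNatEmbed.TopologicalSpace.MetrizableSpace.of_countable_separating
    (fun (n : ℕ) (μ : {μ : FiniteMeasure X // (μ : Measure X) Set.univ ≤ 1}) =>
      ∫ x, (denseSeq C(X, ℝ) n) x ∂(μ.1 : Measure X)) ?_ ?_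
  · intro n
    exact (FiniteMeasure.continuous_integral_continuousMap _).comp continuous_subtype_val
  · intro μ ν hne
    by_contra! hc
    apply hne
    apply Subtype.ext
    apply Subtype.ext
    refine aux_sep (μ := (μ.1 : Measure X)) (ν := (ν.1 : Measure X)) (Set.range (denseSeq C(X, ℝ))) (denseRange_denseSeq _) ?_
    rintro _ ⟨n, rfl⟩
    exact hc n

theorem aux_int {X V : Type} [TopologicalSpace X] [MeasurableSpace X] [BorelSpace X]
    [CompactSpace X] [NormedAddCommGroup V] [NormedSpace ℝ V] [FiniteDimensional ℝ V]
    {f : X → V} (hf : Continuous f) (μ : Measure X) [IsFiniteMeasure μ] : Integrable f μ := by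
  exact hf.integrable_of_hasCompactSupport (HasCompactSupport.of_compactSpace f)

theorem aux_cont {X V Z : Type} [TopologicalSpace X] [MeasurableSpace X] [BorelSpace X]
    [CompactSpace X] [NormedAddCommGroup V] [NormedSpace ℝ V] [FiniteDimensional ℝ V]
    [TopologicalSpace Z] {m : Z → FiniteMeasure X} (hm : Continuous m)
    {f : X → V} (hf : Continuous f) : Continuous (fun z => ∫ x, f x ∂(m z : Measure X)) := by
  let e : V ≃L[ℝ] (Fin (Module.finrank ℝ V) → ℝ) :=
    ContinuousLinearEquiv.ofFinrankEq (by simp)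
  have : (fun z => e (∫ x, f x ∂(m z : Measure X))) =
      fun z i => ∫ x, e (f x) i ∂(m z : Measure X) := by
    funext z i
    have := ((ContinuousLinearMap.proj (R := ℝ) (φ := fun _ : Fin (Module.finrank ℝ V) => ℝ) i).comp
      e.toContinuousLinearMap).integral_comp_comm (aux_int hf (m z : Measure X))
    simpa using this.symm
  have h2 : Continuous (fun z => e (∫ x, f x ∂(m z : Measure X))) := by
    rw [this]
    refine continuous_pi fun i => ?_
    have hc : Continuous fun x => e (f x) i := by fun_prop
    exact (FiniteMeasure.continuous_integral_continuousMap (⟨_, hc⟩ : C(X, ℝ))).comp hm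
  have h3 := e.symm.continuous.comp h2
  simpa [Function.comp_def] using h3

theorem aux_pad (V : Type) [NormedAddCommGroup V] [NormedSpace ℝ V] [FiniteDimensional ℝ V]
    (N : ℕ) (h : Module.finrank ℝ V ≤ N) :
    ∃ (i : V →L[ℝ] EuclideanSpace ℝ (Fin N)) (R : EuclideanSpace ℝ (Fin N) →L[ℝ] V),
      ∀ v, R (i v) = v := by
  let b := Module.finBasis ℝ V
  let c := (EuclideanSpace.basisFun (Fin N) ℝ).toBasis
  let i : V →ₗ[ℝ] EuclideanSpace ℝ (Fin N) := b.constr ℝ fun j => c (Fin.castLE h j)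
  let R : EuclideanSpace ℝ (Fin N) →ₗ[ℝ] V :=
    c.constr ℝ fun j => if hj : (j : ℕ) < Module.finrank ℝ V then b ⟨j, hj⟩ else 0
  have hR : R ∘ₗ i = LinearMap.id := by
    refine b.ext fun j => ?_
    simp only [i, R, LinearMap.comp_apply, Module.Basis.constr_basis]
    simp
  exact ⟨i.toContinuousLinearMap, R.toContinuousLinearMap, fun v => LinearMap.congr_fun hR v⟩

theorem aux_clamp_mul (B : ℝ) (hB : 0 ≤ B) : ∃ (K : ℝ≥0) (g : ℝ × ℝ → ℝ), LipschitzWith K g ∧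
    ∀ x y, |x| ≤ B → |y| ≤ B → g (x, y) = x * y := by
  refine ⟨⟨2 * B, by positivity⟩, fun q => (max (-B) (min B q.1)) * (max (-B) (min B q.2)), ?_, ?_⟩
  · refine LipschitzWith.of_dist_le_mul fun a b => ?_
    have hc : ∀ x : ℝ, |max (-B) (min B x)| ≤ B := fun x =>
      abs_le.2 ⟨le_max_left _ _, max_le (by linarith) (min_le_left _ _)⟩
    have hl : ∀ x y : ℝ, |max (-B) (min B x) - max (-B) (min B y)| ≤ |x - y| := fun x y =>
      (abs_max_sub_max_le_max _ _ _ _).trans (max_le (by simp)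
        ((abs_min_sub_min_le_max _ _ _ _).trans (max_le (by simp) le_rfl)))
    have h1 : |a.1 - b.1| ≤ dist a b := le_max_left _ _
    have h2 : |a.2 - b.2| ≤ dist a b := le_max_right _ _
    rw [Real.dist_eq]
    change _ ≤ 2 * B * dist a b
    set u := max (-B) (min B a.1)
    set v := max (-B) (min B a.2)
    set u' := max (-B) (min B b.1)
    set v' := max (-B) (min B b.2)
    calc |u * v - u' * v'| = |(u - u') * v + u' * (v - v')| := by ring_nf
      _ ≤ |u - u'| * |v| + |u'| * |v - v'| := by
        rw [← abs_mul, ← abs_mul]; exact abs_add_le _ _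
      _ ≤ dist a b * B + B * dist a b := by
        gcongr
        · exact (hl _ _).trans h1
        · exact hc _
        · exact hc _
        · exact (hl _ _).trans h2
      _ = _ := by ring
  · intro x y hx hy
    rw [abs_le] at hx hy
    simp [hx.1, hx.2, hy.1, hy.2]

end Generic

section Concrete
open TopologicalSpace

theorem Hty_good (p : ℕ) (r : ℝ) (t : ℕ) :
    CompactSpace (Hty p r t) ∧ MetrizableSpace (Hty p r t) := by
  induction t with
  | zero =>
    constructor
    · exact isCompact_iff_compactSpace.mp
        (isCompact_closedBall (0 : EuclideanSpace ℝ (Fin p)) r)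
    · change MetrizableSpace (Metric.closedBall (0 : EuclideanSpace ℝ (Fin p)) r)
      infer_instance
  | succ t ih =>
    obtain ⟨h1, h2⟩ := ih
    have h3 := aux_subprob_compact (Hty p r t)
    have h4 := aux_subprob_metrizable (Hty p r t)
    constructor
    · exact (inferInstance : CompactSpace (Hty p r t ×
        {μ : FiniteMeasure (Hty p r t) // (μ : Measure (Hty p r t)) Set.univ ≤ 1}))
    · exact (inferInstance : MetrizableSpace (Hty p r t ×
        {μ : FiniteMeasure (Hty p r t) // (μ : Measure (Hty p r t)) Set.univ ≤ 1}))

instance Hty_compact (p : ℕ) (r : ℝ) (t : ℕ) : CompactSpace (Hty p r t) := (Hty_good p r t).1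

instance Hty_metrizable (p : ℕ) (r : ℝ) (t : ℕ) : MetrizableSpace (Hty p r t) :=
  (Hty_good p r t).2

theorem continuous_toBall (p : ℕ) (r : ℝ) : Continuous (toBall p r) :=
  (continuous_subtype_val : Continuous
    (Subtype.val : Metric.closedBall (0 : EuclideanSpace ℝ (Fin p)) r → _))

theorem toBall_inj (p : ℕ) (r : ℝ) : Function.Injective (toBall p r) :=
  (Subtype.val_injective : Function.Injective
    (Subtype.val : Metric.closedBall (0 : EuclideanSpace ℝ (Fin p)) r → _))

theorem continuous_projH (p : ℕ) (r : ℝ) (t : ℕ) : Continuous (projH p r t) :=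
  (continuous_fst : Continuous (Prod.fst : Hty p r t ×
        {μ : FiniteMeasure (Hty p r t) // (μ : Measure (Hty p r t)) Set.univ ≤ 1} → _))

/-- The measure component, as a finite measure. -/
noncomputable def fmeasOf (p : ℕ) (r : ℝ) (t : ℕ) (τ : Hty p r (t + 1)) :
    FiniteMeasure (Hty p r t) := (toProd p r t τ).2.1

theorem continuous_fmeasOf (p : ℕ) (r : ℝ) (t : ℕ) : Continuous (fmeasOf p r t) :=
  (continuous_subtype_val.comp continuous_snd : Continuous (fun τ : Hty p r t ×
        {μ : FiniteMeasure (Hty p r t) // (μ : Measure (Hty p r t)) Set.univ ≤ 1} => τ.2.1))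

theorem fmeasOf_coe (p : ℕ) (r : ℝ) (t : ℕ) (τ : Hty p r (t + 1)) :
    (fmeasOf p r t τ : Measure (Hty p r t)) = measOf p r t τ := rfl

instance measOf_finite (p : ℕ) (r : ℝ) (t : ℕ) (τ : Hty p r (t + 1)) :
    IsFiniteMeasure (measOf p r t τ) := by
  rw [← fmeasOf_coe]; infer_instance

theorem Hty_ext (p : ℕ) (r : ℝ) (t : ℕ) (τ σ : Hty p r (t + 1))
    (h1 : projH p r t τ = projH p r t σ) (h2 : measOf p r t τ = measOf p r t σ) : τ = σ :=
  Prod.ext (α := Hty p r t) (β := {μ : FiniteMeasure (Hty p r t) //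
    (μ : Measure (Hty p r t)) Set.univ ≤ 1}) h1 (Subtype.ext (Subtype.ext h2))

/-- Feature maps with values in arbitrary finite-dimensional spaces. -/
def IsFeat (p : ℕ) (r : ℝ) : (t : ℕ) → (V : Type) → [NormedAddCommGroup V] → [NormedSpace ℝ V] →
    (Hty p r t → V) → Prop
  | 0, V, _, _, f => ∃ (K : ℝ≥0) (g : EuclideanSpace ℝ (Fin p) → V), LipschitzWith K g ∧
      ∀ τ, f τ = g (toBall p r τ)
  | t + 1, V, _, _, f => ∃ (W : Type) (_ : NormedAddCommGroup W) (_ : NormedSpace ℝ W)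
      (_ : FiniteDimensional ℝ W) (g : Hty p r t → W) (K : ℝ≥0) (φ : W × W → V),
      IsFeat p r t W g ∧ LipschitzWith K φ ∧
      ∀ τ, f τ = φ (g (projH p r t τ), ∫ x, g x ∂(measOf p r t τ))

variable {p : ℕ} {r : ℝ}

theorem IsFeat.continuous {t : ℕ} : ∀ {V : Type} [NormedAddCommGroup V] [NormedSpace ℝ V]
    {f : Hty p r t → V}, IsFeat p r t V f → Continuous f := by
  induction t with
  | zero =>
    rintro V _ _ f ⟨K, g, hg, h⟩
    rw [funext h]
    exact hg.continuous.comp (continuous_toBall p r)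
  | succ t ih =>
    rintro V _ _ f ⟨W, _, _, _, g, K, φ, hg, hφ, h⟩
    rw [funext h]
    have hc := ih hg
    exact hφ.continuous.comp ((hc.comp (continuous_projH p r t)).prodMk
      (aux_cont (continuous_fmeasOf p r t) hc))

theorem IsFeat.comp {t : ℕ} {V W : Type} [NormedAddCommGroup V] [NormedSpace ℝ V]
    [NormedAddCommGroup W] [NormedSpace ℝ W] {f : Hty p r t → V} (hf : IsFeat p r t V f)
    {K : ℝ≥0} {ψ : V → W} (hψ : LipschitzWith K ψ) : IsFeat p r t W (fun τ => ψ (f τ)) := by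
  cases t with
  | zero =>
    obtain ⟨K, g, hg, h⟩ := hf
    exact ⟨_, _, hψ.comp hg, fun τ => by simp [h]⟩
  | succ t =>
    obtain ⟨W, _, _, _, g, K, φ, hg, hφ, h⟩ := hf
    exact ⟨W, _, _, inferInstance, g, _, _, hg, hψ.comp hφ, fun τ => by simp [h]⟩

theorem IsFeat.pair {t : ℕ} : ∀ {V W : Type} [NormedAddCommGroup V] [NormedSpace ℝ V]
    [NormedAddCommGroup W] [NormedSpace ℝ W] {f : Hty p r t → V} {g : Hty p r t → W},
    IsFeat p r t V f → IsFeat p r t W g → IsFeat p r t (V × W) (fun τ => (f τ, g τ)) := by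
  induction t with
  | zero =>
    rintro V W _ _ _ _ f g ⟨K, f', hf, h⟩ ⟨K', g', hg, h'⟩
    exact ⟨_, _, hf.prodMk hg, fun τ => by simp [h, h']⟩
  | succ t ih =>
    rintro V W _ _ _ _ f g ⟨V', _, _, _, f', K, φ, hf, hφ, h⟩ ⟨W', _, _, _, g', K', γ, hg, hγ, h'⟩
    have l1 : LipschitzWith 1 (fun q : (V' × W') × (V' × W') => (q.1.1, q.2.1)) := by
      simpa using (LipschitzWith.prod_fst.comp LipschitzWith.prod_fst).prodMk
        (LipschitzWith.prod_fst.comp LipschitzWith.prod_snd)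
    have l2 : LipschitzWith 1 (fun q : (V' × W') × (V' × W') => (q.1.2, q.2.2)) := by
      simpa using (LipschitzWith.prod_snd.comp LipschitzWith.prod_fst).prodMk
        (LipschitzWith.prod_snd.comp LipschitzWith.prod_snd)
    refine ⟨V' × W', inferInstance, inferInstance, inferInstance, _, _, _, ih hf hg,
      (hφ.comp l1).prodMk (hγ.comp l2), fun τ => ?_⟩
    rw [integral_pair (aux_int hf.continuous _) (aux_int hg.continuous _)]
    simp [h, h']

theorem isFeat_const (t : ℕ) {V : Type} [NormedAddCommGroup V] [NormedSpace ℝ V] (c : V) :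
    IsFeat p r t V (fun _ => c) := by
  induction t generalizing V with
  | zero => exact ⟨0, fun _ => c, LipschitzWith.const c, fun _ => rfl⟩
  | succ t ih =>
    exact ⟨ℝ, _, _, inferInstance, _, 0, fun _ => c, ih (0 : ℝ), LipschitzWith.const c, fun _ => rfl⟩

theorem lip_add : LipschitzWith 2 (fun q : ℝ × ℝ => q.1 + q.2) := by
  have := (LipschitzWith.prod_fst (α := ℝ) (β := ℝ)).add LipschitzWith.prod_snd
  norm_num at this
  exact this

theorem aux_bdd {X : Type} [TopologicalSpace X] [CompactSpace X] (f g : C(X, ℝ)) :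
    ∃ B : ℝ, 0 ≤ B ∧ (∀ x, |f x| ≤ B) ∧ ∀ x, |g x| ≤ B :=
  ⟨‖f‖ + ‖g‖, by positivity,
    fun x => (f.norm_coe_le_norm x).trans (by simp),
    fun x => (g.norm_coe_le_norm x).trans (by simp)⟩

/-- The algebra of scalar features. -/
def featAlg (p : ℕ) (r : ℝ) (t : ℕ) : Subalgebra ℝ C(Hty p r t, ℝ) where
  carrier := {f | IsFeat p r t ℝ f}
  algebraMap_mem' c := isFeat_const t c
  add_mem' {f g} hf hg := (IsFeat.pair hf hg).comp lip_add
  mul_mem' {f g} hf hg := by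
    obtain ⟨B, hB, h1, h2⟩ := aux_bdd f g
    obtain ⟨K, m, hm, h⟩ := aux_clamp_mul B hB
    have := (IsFeat.pair hf hg).comp hm
    have e : (fun τ => m (f τ, g τ)) = ⇑(f * g) := funext fun τ => h _ _ (h1 τ) (h2 τ)
    rw [e] at this
    exact this

theorem featAlg_dense_of_sep {t : ℕ} (h : (featAlg p r t).SeparatesPoints) :
    Dense (featAlg p r t : Set C(Hty p r t, ℝ)) := by
  intro f
  exact ContinuousMap.continuousMap_mem_subalgebra_closure_of_separatesPoints _ h f

theorem featAlg_sep (t : ℕ) : (featAlg p r t).SeparatesPoints := by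
  induction t with
  | zero =>
    intro x y hxy
    have hne : toBall p r x ≠ toBall p r y := fun h => hxy (toBall_inj p r h)
    have hl := LipschitzWith.dist_left (toBall p r x)
    have hF : IsFeat p r 0 ℝ (fun τ => dist (toBall p r τ) (toBall p r x)) :=
      ⟨1, _, hl, fun τ => rfl⟩
    refine ⟨_, ⟨⟨_, hF.continuous⟩, hF, rfl⟩, ?_⟩
    simpa using hne.symm
  | succ t ih =>
    intro x y hxy
    by_cases h1 : projH p r t x = projH p r t y
    · have h2 : measOf p r t x ≠ measOf p r t y := fun h2 => hxy (Hty_ext p r t x y h1 h2)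
      have : ∃ f ∈ (featAlg p r t : Set C(Hty p r t, ℝ)),
          ∫ z, f z ∂(measOf p r t x) ≠ ∫ z, f z ∂(measOf p r t y) := by
        by_contra! hc
        exact h2 (aux_sep _ (featAlg_dense_of_sep ih) hc)
      obtain ⟨f, hf, hne⟩ := this
      have hF : IsFeat p r (t + 1) ℝ (fun τ => ∫ z, f z ∂(measOf p r t τ)) :=
        ⟨ℝ, _, _, inferInstance, f, 1, Prod.snd, hf, LipschitzWith.prod_snd, fun τ => rfl⟩
      exact ⟨_, ⟨⟨_, hF.continuous⟩, hF, rfl⟩, hne⟩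
    · obtain ⟨_, ⟨f, hf, rfl⟩, hne⟩ := ih h1
      have hF : IsFeat p r (t + 1) ℝ (fun τ => f (projH p r t τ)) :=
        ⟨ℝ, _, _, inferInstance, f, 1, Prod.fst, hf, LipschitzWith.prod_fst, fun τ => rfl⟩
      exact ⟨_, ⟨⟨_, hF.continuous⟩, hF, rfl⟩, hne⟩

/-- Readouts of features. -/
def IsRead (p : ℕ) (r : ℝ) (L : ℕ) (F : ProbabilityMeasure (Hty p r L) → ℝ) : Prop :=
  ∃ (W : Type) (_ : NormedAddCommGroup W) (_ : NormedSpace ℝ W)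
      (_ : FiniteDimensional ℝ W) (g : Hty p r L → W) (K : ℝ≥0) (ψ : W → ℝ),
      IsFeat p r L W g ∧ LipschitzWith K ψ ∧ ∀ ν, F ν = ψ (∫ x, g x ∂(ν : Measure (Hty p r L)))

theorem IsRead.continuous {L : ℕ} {F : ProbabilityMeasure (Hty p r L) → ℝ}
    (hF : IsRead p r L F) : Continuous F := by
  obtain ⟨W, _, _, _, g, K, ψ, hg, hψ, h⟩ := hF
  rw [funext h]
  exact hψ.continuous.comp
    (aux_cont (ProbabilityMeasure.toFiniteMeasure_continuous) hg.continuous)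

theorem IsRead.comp {L : ℕ} {F G : ProbabilityMeasure (Hty p r L) → ℝ}
    (hF : IsRead p r L F) (hG : IsRead p r L G) {K : ℝ≥0} {m : ℝ × ℝ → ℝ}
    (hm : LipschitzWith K m) : IsRead p r L (fun ν => m (F ν, G ν)) := by
  obtain ⟨W, _, _, _, g, K, ψ, hg, hψ, h⟩ := hF
  obtain ⟨W', _, _, _, g', K', ψ', hg', hψ', hG⟩ := hG
  refine ⟨W × W', inferInstance, inferInstance, inferInstance, _, _, _, hg.pair hg',
    hm.comp ((hψ.comp LipschitzWith.prod_fst).prodMk (hψ'.comp LipschitzWith.prod_snd)),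
    fun ν => ?_⟩
  rw [integral_pair (aux_int hg.continuous _) (aux_int hg'.continuous _)]
  simp [h, hG]

/-- The algebra of readouts. -/
def readAlg (p : ℕ) (r : ℝ) (L : ℕ) :
    Subalgebra ℝ C(ProbabilityMeasure (Hty p r L), ℝ) where
  carrier := {F | IsRead p r L F}
  algebraMap_mem' c := ⟨ℝ, _, _, inferInstance, _, 0, fun _ => c, isFeat_const L (0 : ℝ),
    LipschitzWith.const c, fun _ => rfl⟩
  add_mem' {f g} hf hg := IsRead.comp hf hg lip_add
  mul_mem' {f g} hf hg := by
    obtain ⟨B, hB, h1, h2⟩ := aux_bdd f g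
    obtain ⟨K, m, hm, h⟩ := aux_clamp_mul B hB
    have := IsRead.comp hf hg hm
    have e : (fun τ => m (f τ, g τ)) = ⇑(f * g) := funext fun τ => h _ _ (h1 τ) (h2 τ)
    rw [e] at this
    exact this

theorem readAlg_sep (L : ℕ) : (readAlg p r L).SeparatesPoints := by
  intro μ ν hne
  have : ∃ f ∈ (featAlg p r L : Set C(Hty p r L, ℝ)),
      ∫ z, f z ∂(μ : Measure (Hty p r L)) ≠ ∫ z, f z ∂(ν : Measure (Hty p r L)) := by
    by_contra! hc
    exact hne (Subtype.ext (aux_sep (μ := (μ : Measure (Hty p r L)))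
      (ν := (ν : Measure (Hty p r L))) _ (featAlg_dense_of_sep (featAlg_sep L)) hc))
  obtain ⟨f, hf, hne⟩ := this
  have hF : IsRead p r L (fun ν => ∫ z, f z ∂(ν : Measure (Hty p r L))) :=
    ⟨ℝ, _, _, inferInstance, f, 1, id, hf, LipschitzWith.id, fun τ => rfl⟩
  exact ⟨_, ⟨⟨_, hF.continuous⟩, hF, rfl⟩, hne⟩

/-- MPNN with constant dimension, from sequences of maps. -/
noncomputable def mkNet (N : ℕ) (K0 : ℝ≥0) (Ks : ℕ → ℝ≥0)
    (φ0 : EuclideanSpace ℝ (Fin p) → EuclideanSpace ℝ (Fin N))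
    (φ : ℕ → EuclideanSpace ℝ (Fin N) × EuclideanSpace ℝ (Fin N) → EuclideanSpace ℝ (Fin N))
    (h0 : LipschitzWith K0 φ0) (h : ∀ t, LipschitzWith (Ks t) (φ t)) : MPNN p where
  dims _ := N
  K0 := K0
  Ks := Ks
  φ0 := φ0
  φ := φ
  lip0 := h0
  lip := h

theorem mkNet_feat_congr (N : ℕ) (K0 : ℝ≥0) (Ks Ks' : ℕ → ℝ≥0)
    (φ0 : EuclideanSpace ℝ (Fin p) → EuclideanSpace ℝ (Fin N))
    (φ φ' : ℕ → EuclideanSpace ℝ (Fin N) × EuclideanSpace ℝ (Fin N) → EuclideanSpace ℝ (Fin N))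
    (h0 : LipschitzWith K0 φ0) (h : ∀ t, LipschitzWith (Ks t) (φ t))
    (h' : ∀ t, LipschitzWith (Ks' t) (φ' t)) (t : ℕ) (heq : ∀ s < t, φ s = φ' s) :
    feat p r (mkNet N K0 Ks φ0 φ h0 h) t = feat p r (mkNet N K0 Ks' φ0 φ' h0 h') t := by
  induction t with
  | zero => rfl
  | succ t ih =>
    have ih := ih fun s hs => heq s (by omega)
    funext τ
    change φ t _ = φ' t _
    rw [heq t (by omega), ih]
    rfl

theorem feat_isFeat (Φ : MPNN p) (t : ℕ) : IsFeat p r t _ (feat p r Φ t) := by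
  induction t with
  | zero => exact ⟨_, _, Φ.lip0, fun _ => rfl⟩
  | succ t ih => exact ⟨_, _, _, inferInstance, _, _, _, ih, Φ.lip t, fun _ => rfl⟩

theorem IsFeat.realize {t : ℕ} : ∀ {V : Type} [NormedAddCommGroup V] [NormedSpace ℝ V]
    [FiniteDimensional ℝ V] {f : Hty p r t → V}, IsFeat p r t V f →
    ∃ N0 : ℕ, ∀ N ≥ N0, ∃ (K0 : ℝ≥0) (Ks : ℕ → ℝ≥0)
      (φ0 : EuclideanSpace ℝ (Fin p) → EuclideanSpace ℝ (Fin N))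
      (φ : ℕ → EuclideanSpace ℝ (Fin N) × EuclideanSpace ℝ (Fin N) → EuclideanSpace ℝ (Fin N))
      (h0 : LipschitzWith K0 φ0) (h : ∀ t, LipschitzWith (Ks t) (φ t))
      (R : EuclideanSpace ℝ (Fin N) →L[ℝ] V),
      ∀ τ, f τ = R (feat p r (mkNet N K0 Ks φ0 φ h0 h) t τ) := by
  induction t with
  | zero =>
    rintro V _ _ _ f ⟨K, g, hg, h⟩
    refine ⟨Module.finrank ℝ V, fun N hN => ?_⟩
    obtain ⟨i, R, hR⟩ := aux_pad V N hN
    refine ⟨_, fun _ => 0, fun x => i (g x), fun _ _ => 0, i.lipschitz.comp hg,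
      fun _ => LipschitzWith.const 0, R, fun τ => ?_⟩
    change _ = R (i (g _))
    rw [hR, h]
  | succ t ih =>
    rintro V _ _ _ f ⟨W, _, _, _, g, K, γ, hg, hγ, hf⟩
    obtain ⟨N0, hN0⟩ := ih hg
    refine ⟨max N0 (Module.finrank ℝ V), fun N hN => ?_⟩
    obtain ⟨K0, Ks, φ0, φ, h0, h, R, hR⟩ := hN0 N (le_trans (le_max_left _ _) hN)
    obtain ⟨i, S, hS⟩ := aux_pad V N (le_trans (le_max_right _ _) hN)
    let ω : EuclideanSpace ℝ (Fin N) × EuclideanSpace ℝ (Fin N) → EuclideanSpace ℝ (Fin N) :=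
      fun q => i (γ (R q.1, R q.2))
    obtain ⟨Kω, hω⟩ : ∃ Kω, LipschitzWith Kω ω :=
      ⟨_, i.lipschitz.comp (hγ.comp ((R.lipschitz.comp LipschitzWith.prod_fst).prodMk
        (R.lipschitz.comp LipschitzWith.prod_snd)))⟩
    have h' : ∀ s, LipschitzWith (Function.update Ks t Kω s) (Function.update φ t ω s) := by
      intro s
      by_cases hs : s = t
      · subst hs; simpa using hω
      · simpa [hs] using h s
    refine ⟨K0, Function.update Ks t Kω, φ0, Function.update φ t ω, h0, h', S, fun τ => ?_⟩
    have hcongr := mkNet_feat_congr (r := r) N K0 Ks (Function.update Ks t Kω) φ0 φ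
      (Function.update φ t ω) h0 h h' t
      (fun s hs => by rw [Function.update_of_ne (by omega)])
    have hstep : feat p r (mkNet N K0 (Function.update Ks t Kω) φ0 (Function.update φ t ω) h0 h')
        (t + 1) τ = ω (feat p r (mkNet N K0 Ks φ0 φ h0 h) t (projH p r t τ),
          ∫ x, feat p r (mkNet N K0 Ks φ0 φ h0 h) t x ∂(measOf p r t τ)) := by
      rw [hcongr]
      change Function.update φ t ω t _ = _
      rw [Function.update_self]
      rfl
    rw [hstep]
    simp only [ω]
    rw [hS, hf, hR]
    congr 2
    have hRi := R.integral_comp_comm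
      (aux_int (feat_isFeat (r := r) (mkNet N K0 Ks φ0 φ h0 h) t).continuous (measOf p r t τ))
    refine Eq.trans ?_ hRi
    exact integral_congr_ae (Filter.Eventually.of_forall hR)

theorem IsRead.mem_NNL {L : ℕ} {F : ProbabilityMeasure (Hty p r L) → ℝ}
    (hF : IsRead p r L F) : F ∈ NNL p r L := by
  obtain ⟨W, _, _, _, g, K, ψ, hg, hψ, hF⟩ := hF
  obtain ⟨N, hN⟩ := hg.realize
  obtain ⟨K0, Ks, φ0, φ, h0, h, R, hR⟩ := hN N le_rfl
  refine ⟨mkNet N K0 Ks φ0 φ h0 h, fun x => ψ (R x), _, hψ.comp R.lipschitz, fun ν => ?_⟩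
  rw [hF]
  congr 1
  have := R.integral_comp_comm (aux_int (feat_isFeat (r := r) (mkNet N K0 Ks φ0 φ h0 h) L).continuous
    (ν : Measure (Hty p r L)))
  refine Eq.trans ?_ this
  exact integral_congr_ae (Filter.Eventually.of_forall hR)

end Concrete

/-- Universal approximation on distributions of iterated degree measures: the set
`NN¹_L` is uniformly dense in `C(P(H^L), ℝ)`, where `P(H^L)` carries the weak* topology. -/
theorem NNL_dense (p L : ℕ) (r : ℝ) (hr : 0 < r) :
    ∀ G : ProbabilityMeasure (Hty p r L) → ℝ, Continuous G → ∀ ε > 0,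
      ∃ F ∈ NNL p r L, ∀ ν, |G ν - F ν| ≤ ε := by
  intro G hG ε hε
  obtain ⟨g, hg⟩ := ContinuousMap.exists_mem_subalgebra_near_continuous_of_separatesPoints
    (readAlg p r L) (readAlg_sep L) G hG ε hε
  refine ⟨g.1, IsRead.mem_NNL g.2, fun ν => ?_⟩
  rw [abs_sub_comm]
  exact (hg ν).le
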